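/- Fix q > 1 and let ζ(s) = (1-q^{-s})^{-1}. For m ≥ 1, set χ̃_i = -(m+1-i) and ξ_j = -(m+1/2-j) as rational numbers, and consider the type-C_m Weyl denominators: A(P̃) = ∏_{1≤a<b≤m} ζ^{-1}(-χ̃_a+χ̃_b) ζ^{-1}(-χ̃_a-χ̃_b) · ∏_{i=1}^m ζ^{-1}(-χ̃_i) · q^{-⟨χ̃, ρ̃₁⟩-like exponent} — more concretely: prove the scalar identity that with χ̃_i = -(m+1-i), ξ_j = -(m+1/2-j), the quantity Ã(χ̃,ξ) / (A_{W_M}(P̃(χ̃)) · A_{W_M}(Q(ξ))) equals ζ(1)^m ∏_{i=1}^m ζ^{-1}(2i), where Ã(χ̃,ξ) = ∏_{i<j} ζ^{-1}(-χ̃_i+ξ_j+1/2) ∏_{i>j} ζ^{-1}(χ̃_i-ξ_j+1/2) ∏_j ζ^{-1}(-ξ_j+1/2) ∏_{i,j} ζ^{-1}(-χ̃_i-ξ_j+1/2) · q^{-Σ_i (m-i+1/2)χ̃_i} q^{-Σ_j (m-j+1)ξ_j}, A_{W_M}(P̃(χ̃)) = ∏_{a<b} ζ^{-1}(-χ̃_a+χ̃_b)ζ^{-1}(-χ̃_a-χ̃_b)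 ∏_i ζ^{-1}(-χ̃_i) · q^{-Σ_i (m-i+1/2)χ̃_i}, and A_{W_M}(Q(ξ)) = ∏_{a<b} ζ^{-1}(-ξ_a+ξ_b)ζ^{-1}(-ξ_a-ξ_b) ∏_j ζ^{-1}(-2ξ_j) · q^{-Σ_j (m-j+1)ξ_j}, where ζ^{-1}(s) = 1 - q^{-s}. -/

import Mathlib

/-- `ζ(s)⁻¹ = 1 - q^{-s}` for a rational argument `s`, `q` real. -/
noncomputable def zetaInv (q : ℝ) (s : ℚ) : ℝ := 1 - q ^ (-(s : ℝ))

/-- `q^x` for a rational exponent. -/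
noncomputable def qpow (q : ℝ) (x : ℚ) : ℝ := q ^ (x : ℝ)

theorem zetaInv_ne_zero {q : ℝ} (hq : 1 < q) {s : ℚ} (hs : 0 < s) : zetaInv q s ≠ 0 := by
  have h : q ^ (-(s : ℝ)) < 1 :=
    Real.rpow_lt_one_of_one_lt_of_neg hq (by simpa using hs)
  unfold zetaInv
  linarith

theorem prod_range_ite_lt_telescope {M : Type*} [CommMonoid M] (h : ℕ → M) {a m : ℕ}
    (ham : a < m) :
    (∏ b ∈ Finset.range m, if a < b then h (b + 1) else 1) * h (a + 1) =
      (∏ b ∈ Finset.range m, if a < b then h b else 1) * h m := by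
  induction m, ham using Nat.le_induction with
  | base =>
    have key (g : ℕ → M) : (∏ b ∈ Finset.range (a + 1), if a < b then g b else 1) = 1 :=
      Finset.prod_eq_one fun b hb => if_neg (by have := Finset.mem_range.1 hb; omega)
    rw [key h, key fun b => h (b + 1)]
  | succ n hn ih =>
    have hn' : a < n := hn
    rw [Finset.prod_range_succ, Finset.prod_range_succ, if_pos hn', if_pos hn',
      mul_right_comm, ih]

theorem prod_fin_ite_lt_telescope {M : Type*} [CommMonoid M] (h : ℕ → M) {m : ℕ} (a : Fin m) :
    (∏ b : Fin m, if a < b then h (b + 1) else 1) * h (a + 1) =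
      (∏ b : Fin m, if a < b then h b else 1) * h m := by
  simpa only [Fin.lt_def, ← Fin.prod_univ_eq_prod_range
    (fun b => if (a : ℕ) < b then h (b + 1) else 1),
    ← Fin.prod_univ_eq_prod_range (fun b => if (a : ℕ) < b then h b else 1)] using
    prod_range_ite_lt_telescope h a.isLt

theorem prod_prod_eq_ite_lt_sq_mul_diag {ι M : Type*} [Fintype ι] [LinearOrder ι] [CommMonoid M]
    (F : ι → ι → M) (hF : ∀ a b, F a b = F b a) :
    ∏ a, ∏ b, F a b =
      (∏ a, ∏ b, if a < b then F a b else 1) * (∏ a, ∏ b, if a < b then F a b else 1) *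
        ∏ a, F a a := by
  have h1 : (∏ a, ∏ b, if a < b then F a b else 1) = ∏ a, ∏ b, if b < a then F a b else 1 := by
    rw [Finset.prod_comm]
    simp only [hF]
  have h2 : ∏ a, F a a = ∏ a, ∏ b, if a = b then F a b else 1 := by simp
  nth_rewrite 2 [h1]
  rw [h2]
  simp only [← Finset.prod_mul_distrib]
  refine Finset.prod_congr rfl fun a _ => Finset.prod_congr rfl fun b _ => ?_
  rcases lt_trichotomy a b with h | h | h
  · simp [h, h.not_gt, h.ne]
  · simp [h]
  · simp [h, h.not_gt, h.ne']

/-- With `q > 1`, `ζ(s) = (1-q^{-s})⁻¹`, `χ̃_i = -(m+1-i)` and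
`ξ_j = -(m+1/2-j)` (1-based; here 0-based: `χ i = i - m`, `ξ j = j + 1/2 - m`), the
quantity `Ã(χ̃,ξ) / (A_{W_M}(P̃(χ̃)) · A_{W_M}(Q(ξ)))` equals
`ζ(1)^m ∏_{i=1}^m ζ⁻¹(2i)`, with `Ã`, `A_{W_M}(P̃)`, `A_{W_M}(Q)` given by the explicit
products of `ζ⁻¹`-factors and exponential factors below. -/
theorem stmt13 (q : ℝ) (hq : 1 < q) (m : ℕ) (hm : 0 < m)
    (χ ξ : Fin m → ℚ)
    (hχ : ∀ i, χ i = (i : ℚ) - m) (hξ : ∀ j, ξ j = (j : ℚ) + 1/2 - m) :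
    ((∏ i : Fin m, ∏ j : Fin m, if i < j then zetaInv q (-(χ i) + ξ j + 1/2) else 1) *
     (∏ i : Fin m, ∏ j : Fin m, if j < i then zetaInv q (χ i - ξ j + 1/2) else 1) *
     (∏ j : Fin m, zetaInv q (-(ξ j) + 1/2)) *
     (∏ i : Fin m, ∏ j : Fin m, zetaInv q (-(χ i) - ξ j + 1/2)) *
     qpow q (-(∑ i : Fin m, ((m : ℚ) - i - 1/2) * χ i)) *
     qpow q (-(∑ j : Fin m, ((m : ℚ) - j) * ξ j))) /
    (((∏ a : Fin m, ∏ b : Fin m,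
          if a < b then zetaInv q (-(χ a) + χ b) * zetaInv q (-(χ a) - χ b) else 1) *
      (∏ i : Fin m, zetaInv q (-(χ i))) *
      qpow q (-(∑ i : Fin m, ((m : ℚ) - i - 1/2) * χ i))) *
     ((∏ a : Fin m, ∏ b : Fin m,
          if a < b then zetaInv q (-(ξ a) + ξ b) * zetaInv q (-(ξ a) - ξ b) else 1) *
      (∏ j : Fin m, zetaInv q (-(2 * ξ j))) *
      qpow q (-(∑ j : Fin m, ((m : ℚ) - j) * ξ j)))) =
    (zetaInv q 1)⁻¹ ^ m * ∏ i : Fin m, zetaInv q (2 * ((i : ℚ) + 1)) := by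
  have hlt (a : Fin m) : (a : ℚ) + 1 ≤ m := by exact_mod_cast a.isLt
  have hite (F : Fin m → Fin m → ℚ) (hF : ∀ a b : Fin m, (a : ℚ) + 1 ≤ b → 0 < F a b) :
      (∏ a : Fin m, ∏ b : Fin m, if a < b then zetaInv q (F a b) else 1) ≠ 0 := by
    refine Finset.prod_ne_zero_iff.2 fun a _ => Finset.prod_ne_zero_iff.2 fun b _ => ?_
    split_ifs with h
    · exact zetaInv_ne_zero hq (hF a b (by exact_mod_cast h))
    · exact one_ne_zero
  have hone (F : Fin m → ℚ) (hF : ∀ a, 0 < F a) : (∏ a, zetaInv q (F a)) ≠ 0 :=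
    Finset.prod_ne_zero_iff.2 fun a _ => zetaInv_ne_zero hq (hF a)
  have e1 (i j : Fin m) : -(χ i) + ξ j + 1/2 = (j : ℚ) + 1 - i := by rw [hχ, hξ]; ring
  have e2 (i j : Fin m) : χ i - ξ j + 1/2 = (i : ℚ) - j := by rw [hχ, hξ]; ring
  have e3 (j : Fin m) : -(ξ j) + 1/2 = (m : ℚ) - j := by rw [hξ]; ring
  have e4 (i j : Fin m) : -(χ i) - ξ j + 1/2 = 2 * (m : ℚ) - i - j := by rw [hχ, hξ]; ring
  have e5 (a b : Fin m) : -(χ a) + χ b = (b : ℚ) - a := by rw [hχ, hχ]; ring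
  have e6 (a b : Fin m) : -(χ a) - χ b = 2 * (m : ℚ) - a - b := by rw [hχ, hχ]; ring
  have e7 (i : Fin m) : -(χ i) = (m : ℚ) - i := by rw [hχ]; ring
  have e8 (a b : Fin m) : -(ξ a) + ξ b = (b : ℚ) - a := by rw [hξ, hξ]; ring
  have e9 (a b : Fin m) : -(ξ a) - ξ b = 2 * (m : ℚ) - a - (b + 1) := by rw [hξ, hξ]; ring
  have e10 (j : Fin m) : -(2 * ξ j) = 2 * (m : ℚ) - j - (j + 1) := by rw [hξ]; ring
  have hx : qpow q (-(∑ i : Fin m, ((m : ℚ) - i - 1/2) * χ i)) ≠ 0 :=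
    (Real.rpow_pos_of_pos (by linarith) _).ne'
  have hy : qpow q (-(∑ j : Fin m, ((m : ℚ) - j) * ξ j)) ≠ 0 :=
    (Real.rpow_pos_of_pos (by linarith) _).ne'
  generalize qpow q (-(∑ i : Fin m, ((m : ℚ) - i - 1/2) * χ i)) = x at hx ⊢
  generalize qpow q (-(∑ j : Fin m, ((m : ℚ) - j) * ξ j)) = y at hy ⊢
  have split (F G : Fin m → Fin m → ℝ) :
      (∏ a, ∏ b, if a < b then F a b * G a b else 1) =
        (∏ a, ∏ b, if a < b then F a b else 1) * ∏ a, ∏ b, if a < b then G a b else 1 := by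
    simp only [← Finset.prod_mul_distrib]
    refine Finset.prod_congr rfl fun a _ => Finset.prod_congr rfl fun b _ => ?_
    split_ifs <;> simp
  have hG : ∏ i : Fin m, zetaInv q (2 * ((i : ℚ) + 1)) =
      ∏ a : Fin m, zetaInv q (2 * (m : ℚ) - a - a) := by
    rw [← Equiv.prod_comp Fin.revPerm]
    refine Finset.prod_congr rfl fun a _ => ?_
    congr 1
    rw [Fin.revPerm_apply, Fin.val_rev, Nat.cast_sub a.isLt]
    push_cast
    ring
  have hT : (∏ a : Fin m, ∏ b : Fin m, if a < b then zetaInv q ((b : ℚ) + 1 - a) else 1) *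
      zetaInv q 1 ^ m =
      (∏ a : Fin m, ∏ b : Fin m, if a < b then zetaInv q ((b : ℚ) - a) else 1) *
        ∏ a : Fin m, zetaInv q ((m : ℚ) - a) := by
    have hc : zetaInv q 1 ^ m = ∏ _a : Fin m, zetaInv q 1 := by simp
    rw [hc, ← Finset.prod_mul_distrib, ← Finset.prod_mul_distrib]
    refine Finset.prod_congr rfl fun a _ => ?_
    simpa using prod_fin_ite_lt_telescope (fun b : ℕ => zetaInv q ((b : ℚ) - (a : ℕ))) a
  have hS : (∏ a : Fin m, ∏ b : Fin m,
        if a < b then zetaInv q (2 * (m : ℚ) - a - (b + 1)) else 1) *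
      (∏ a : Fin m, zetaInv q (2 * (m : ℚ) - a - (a + 1))) =
      (∏ a : Fin m, ∏ b : Fin m, if a < b then zetaInv q (2 * (m : ℚ) - a - b) else 1) *
        ∏ a : Fin m, zetaInv q ((m : ℚ) - a) := by
    rw [← Finset.prod_mul_distrib, ← Finset.prod_mul_distrib]
    refine Finset.prod_congr rfl fun a _ => ?_
    have h := prod_fin_ite_lt_telescope (fun b : ℕ => zetaInv q (2 * (m : ℚ) - (a : ℕ) - b)) a
    rw [show 2 * (m : ℚ) - (a : ℕ) - m = m - (a : ℕ) by ring] at h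
    simpa using h
  have hlow : (∏ i : Fin m, ∏ j : Fin m, if j < i then zetaInv q ((i : ℚ) - j) else 1) =
      ∏ a : Fin m, ∏ b : Fin m, if a < b then zetaInv q ((b : ℚ) - a) else 1 :=
    Finset.prod_comm
  simp only [split, e1, e2, e3, e4, e5, e6, e8, e9, e10]
  simp only [e7, hlow, hG]
  rw [prod_prod_eq_ite_lt_sq_mul_diag (fun a b : Fin m => zetaInv q (2 * (m : ℚ) - a - b))
    fun a b => congrArg (zetaInv q) (by ring), inv_pow]
  have hT0 := hite (fun a b => (b : ℚ) - a) fun a b h => by linarith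
  have hS0 := hite (fun a b => 2 * (m : ℚ) - a - b) fun a b _ => by linarith [hlt a, hlt b]
  have hS1 := hite (fun a b => 2 * (m : ℚ) - a - (b + 1)) fun a b _ => by
    linarith [hlt a, hlt b]
  have hN := hone (fun a => (m : ℚ) - a) fun a => by linarith [hlt a]
  have hH := hone (fun a => 2 * (m : ℚ) - a - (a + 1)) fun a => by linarith [hlt a]
  have hc : zetaInv q 1 ^ m ≠ 0 := pow_ne_zero _ (zetaInv_ne_zero hq one_pos)
  generalize (∏ a : Fin m, ∏ b : Fin m, if a < b then zetaInv q ((b : ℚ) + 1 - a) else 1) = T1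
    at *
  generalize (∏ a : Fin m, ∏ b : Fin m, if a < b then zetaInv q ((b : ℚ) - a) else 1) = T0 at *
  generalize (∏ a : Fin m, ∏ b : Fin m,
    if a < b then zetaInv q (2 * (m : ℚ) - a - b) else 1) = S0 at *
  generalize (∏ a : Fin m, ∏ b : Fin m,
    if a < b then zetaInv q (2 * (m : ℚ) - a - (b + 1)) else 1) = S1 at *
  generalize (∏ a : Fin m, zetaInv q ((m : ℚ) - a)) = N at *
  generalize (∏ a : Fin m, zetaInv q (2 * (m : ℚ) - a - (a + 1))) = H at *
  generalize (∏ a : Fin m, zetaInv q (2 * (m : ℚ) - a - a)) = G at *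
  generalize zetaInv q 1 ^ m = c at *
  rw [inv_mul_eq_div, div_eq_div_iff (by positivity) hc]
  linear_combination (T0 * N * S0 * S0 * G * x * y) * hT - (G * T0 * S0 * N * x * T0 * y) * hS
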